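/- There exists a constant c > 0 such that for all θ > 0, the variance of log X under the Gamma(θ,1) distribution satisfies Var_θ(log X) ≤ c + 2·(E_θ log X)²; equivalently, the trigamma function satisfies ψ'(θ) ≤ c + 2·ψ(θ)² for all θ > 0, where ψ is the digamma function (so that E_θ log X = ψ(θ) and Var_θ log X = ψ'(θ)). -/

import Mathlib

open MeasureTheory ProbabilityTheory

noncomputable section

/-- The digamma function `ψ(θ) = d(log Γ(θ))/dθ`. -/
def digamma (x : ℝ) : ℝ := deriv (fun y => Real.log (Real.Gamma y)) x

open Set Filter Topology

lemma gammaPDF_toReal_mul_exp_log_ae_eq {θ : ℝ} (hθ : 0 < θ) (t : ℝ) :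
    (fun x ↦ (gammaPDF θ 1 x).toReal • Real.exp (t * Real.log x)) =ᵐ[volume]
      (Ioi 0).indicator
        (fun x ↦ (Real.Gamma θ)⁻¹ * (Real.exp (-x) * x ^ (θ + t - 1))) := by
  filter_upwards [Measure.ae_ne volume (0 : ℝ)] with x hx
  rcases lt_or_gt_of_ne hx with h | h
  · rw [gammaPDF_of_neg h, indicator_of_notMem (by simpa using h.le)]
    simp
  · rw [gammaPDF, ENNReal.toReal_ofReal (gammaPDFReal_nonneg hθ one_pos x),
      indicator_of_mem (mem_Ioi.2 h), gammaPDFReal, if_pos h.le,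
      show θ + t - 1 = (θ - 1) + t by ring, Real.rpow_add h, Real.rpow_def_of_pos h t,
      mul_comm (Real.log x) t, Real.one_rpow, one_mul, smul_eq_mul]
    ring

lemma integrable_exp_mul_log_gammaMeasure {θ t : ℝ} (hθ : 0 < θ) (ht : -θ < t) :
    Integrable (fun x ↦ Real.exp (t * Real.log x)) (gammaMeasure θ 1) := by
  rw [gammaMeasure, integrable_withDensity_iff_integrable_smul' (f := gammaPDF θ 1)
    (measurable_gammaPDFReal θ 1).ennreal_ofReal (ae_of_all _ fun _ ↦ ENNReal.ofReal_lt_top),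
    integrable_congr (gammaPDF_toReal_mul_exp_log_ae_eq hθ t),
    integrable_indicator_iff measurableSet_Ioi]
  exact (Real.GammaIntegral_convergent (by linarith)).const_mul _

lemma mgf_log_gammaMeasure {θ t : ℝ} (hθ : 0 < θ) (ht : -θ < t) :
    mgf Real.log (gammaMeasure θ 1) t = Real.Gamma (θ + t) / Real.Gamma θ := by
  rw [mgf, gammaMeasure, integral_withDensity_eq_integral_toReal_smul (f := gammaPDF θ 1)
    (measurable_gammaPDFReal θ 1).ennreal_ofReal (ae_of_all _ fun _ ↦ ENNReal.ofReal_lt_top),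
    integral_congr_ae (gammaPDF_toReal_mul_exp_log_ae_eq hθ t),
    integral_indicator measurableSet_Ioi, integral_const_mul,
    ← Real.Gamma_eq_integral (by linarith), div_eq_inv_mul]

lemma cgf_log_gammaMeasure {θ t : ℝ} (hθ : 0 < θ) (ht : -θ < t) :
    cgf Real.log (gammaMeasure θ 1) t =
      Real.log (Real.Gamma (θ + t)) - Real.log (Real.Gamma θ) := by
  rw [cgf, mgf_log_gammaMeasure hθ ht,
    Real.log_div (Real.Gamma_pos_of_pos (by linarith)).ne' (Real.Gamma_pos_of_pos hθ).ne']

lemma zero_mem_interior_integrableExpSet_log_gammaMeasure {θ : ℝ} (hθ : 0 < θ) :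
    0 ∈ interior (integrableExpSet Real.log (gammaMeasure θ 1)) :=
  mem_interior.2 ⟨Ioi (-θ), fun _ ht ↦ integrable_exp_mul_log_gammaMeasure hθ ht,
    isOpen_Ioi, by simpa using hθ⟩

lemma cgf_log_gammaMeasure_eventuallyEq {θ : ℝ} (hθ : 0 < θ) :
    cgf Real.log (gammaMeasure θ 1) =ᶠ[𝓝 0]
      fun t ↦ Real.log (Real.Gamma (θ + t)) - Real.log (Real.Gamma θ) := by
  filter_upwards [Ioi_mem_nhds (neg_lt_zero.2 hθ)] with t ht
  exact cgf_log_gammaMeasure hθ ht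

lemma deriv_cgf_log_gammaMeasure_eventuallyEq {θ : ℝ} (hθ : 0 < θ) :
    deriv (cgf Real.log (gammaMeasure θ 1)) =ᶠ[𝓝 0] fun t ↦ digamma (θ + t) := by
  filter_upwards [(cgf_log_gammaMeasure_eventuallyEq hθ).deriv] with t ht
  rw [ht, deriv_sub_const, digamma,
    deriv_comp_const_add (f := fun y ↦ Real.log (Real.Gamma y))]

lemma analyticAt_log_Gamma {θ : ℝ} (hθ : 0 < θ) :
    AnalyticAt ℝ (fun y ↦ Real.log (Real.Gamma y)) θ := by
  have h := analyticAt_cgf (zero_mem_interior_integrableExpSet_log_gammaMeasure hθ)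
  rw [← sub_self θ] at h
  have h' := (h.comp (f := fun y ↦ y - θ) (analyticAt_id.sub analyticAt_const)).add
    (analyticAt_const (v := Real.log (Real.Gamma θ)))
  refine h'.congr ?_
  filter_upwards [Ioi_mem_nhds hθ] with y hy
  have hy : 0 < y := hy
  simp [cgf_log_gammaMeasure hθ (t := y - θ) (by linarith)]

lemma analyticAt_digamma {θ : ℝ} (hθ : 0 < θ) : AnalyticAt ℝ digamma θ :=
  (analyticAt_log_Gamma hθ).deriv

lemma integral_log_gammaMeasure {θ : ℝ} (hθ : 0 < θ) :
    ∫ x, Real.log x ∂(gammaMeasure θ 1) = digamma θ := by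
  have := isProbabilityMeasure_gammaMeasure hθ one_pos
  have h := deriv_cgf_zero (zero_mem_interior_integrableExpSet_log_gammaMeasure hθ)
  rw [(deriv_cgf_log_gammaMeasure_eventuallyEq hθ).eq_of_nhds] at h
  simpa using h.symm

lemma integral_sq_log_sub_gammaMeasure {θ : ℝ} (hθ : 0 < θ) :
    ∫ x, (Real.log x - ∫ y, Real.log y ∂(gammaMeasure θ 1)) ^ 2 ∂(gammaMeasure θ 1) =
      deriv digamma θ := by
  have := isProbabilityMeasure_gammaMeasure hθ one_pos
  have h := iteratedDeriv_two_cgf_eq_integral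
    (zero_mem_interior_integrableExpSet_log_gammaMeasure hθ)
  rw [iteratedDeriv_succ, iteratedDeriv_one,
    (deriv_cgf_log_gammaMeasure_eventuallyEq hθ).deriv_eq,
    (deriv_cgf_log_gammaMeasure_eventuallyEq hθ).eq_of_nhds,
    deriv_comp_const_add (f := digamma)] at h
  simpa [integral_log_gammaMeasure hθ] using h.symm

lemma digamma_add_one {θ : ℝ} (hθ : 0 < θ) : digamma (θ + 1) = digamma θ + θ⁻¹ := by
  have h : (fun y ↦ Real.log (Real.Gamma (y + 1))) =ᶠ[𝓝 θ]
      fun y ↦ Real.log (Real.Gamma y) + Real.log y := by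
    filter_upwards [Ioi_mem_nhds hθ] with y hy
    have hy : 0 < y := hy
    rw [Real.Gamma_add_one hy.ne', Real.log_mul hy.ne' (Real.Gamma_pos_of_pos hy).ne', add_comm]
  rw [digamma, ← deriv_comp_add_const (f := fun y ↦ Real.log (Real.Gamma y)), h.deriv_eq,
    deriv_fun_add (analyticAt_log_Gamma hθ).differentiableAt
      (Real.differentiableAt_log hθ.ne'), Real.deriv_log, digamma]

lemma deriv_digamma_add_one {θ : ℝ} (hθ : 0 < θ) :
    deriv digamma (θ + 1) = deriv digamma θ - (θ ^ 2)⁻¹ := by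
  have h : (fun y ↦ digamma (y + 1)) =ᶠ[𝓝 θ] fun y ↦ digamma y + y⁻¹ := by
    filter_upwards [Ioi_mem_nhds hθ] with y hy using digamma_add_one hy
  rw [← deriv_comp_add_const (f := digamma), h.deriv_eq,
    deriv_fun_add (analyticAt_digamma hθ).differentiableAt (differentiableAt_inv hθ.ne'),
    deriv_inv, sub_eq_add_neg]

lemma exists_deriv_digamma_le : ∃ K : ℝ, ∀ θ : ℝ, 1 ≤ θ → deriv digamma θ ≤ K := by
  obtain ⟨K, hK⟩ := (isCompact_Icc (a := (1 : ℝ)) (b := 2)).bddAbove_image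
    (f := deriv digamma) fun x hx ↦
      (analyticAt_digamma (by linarith [hx.1])).deriv.continuousAt.continuousWithinAt
  refine ⟨K, fun θ hθ ↦ ?_⟩
  have step (n : ℕ) : ∀ x ∈ Icc (1 : ℝ) 2, deriv digamma (x + n) ≤ K := by
    induction n with
    | zero => exact fun x hx ↦ by simpa using hK (mem_image_of_mem _ hx)
    | succ n ih =>
      intro x hx
      have hpos : 0 < x + n := by linarith [hx.1, n.cast_nonneg (α := ℝ)]
      rw [Nat.cast_succ, ← add_assoc, deriv_digamma_add_one hpos]
      linarith [ih x hx, inv_nonneg.2 (sq_nonneg (x + n))]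
  have hfloor := Nat.floor_le (sub_nonneg.2 hθ)
  have hlt := Nat.lt_floor_add_one (θ - 1)
  simpa using step ⌊θ - 1⌋₊ (θ - ⌊θ - 1⌋₊) ⟨by linarith, by linarith⟩

lemma exists_deriv_digamma_le_add_two_mul_sq :
    ∃ c : ℝ, 0 < c ∧ ∀ θ : ℝ, 0 < θ → deriv digamma θ ≤ c + 2 * digamma θ ^ 2 := by
  obtain ⟨K, hK⟩ := exists_deriv_digamma_le
  obtain ⟨M, hM⟩ := (isCompact_Icc (a := (1 : ℝ)) (b := 2)).bddAbove_image
    (f := fun x ↦ digamma x ^ 2) fun x hx ↦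
      ((analyticAt_digamma (by linarith [hx.1])).continuousAt.pow 2).continuousWithinAt
  have hM0 : 0 ≤ M := (sq_nonneg _).trans
    (hM (mem_image_of_mem _ (left_mem_Icc.2 (one_le_two (α := ℝ)))))
  refine ⟨|K| + 2 * M + 1, by positivity, fun θ hθ ↦ ?_⟩
  have hKabs := le_abs_self K
  rcases le_total 1 θ with h | h
  · linarith [hK θ h, sq_nonneg (digamma θ)]
  · have hM' : digamma (θ + 1) ^ 2 ≤ M :=
      hM (mem_image_of_mem _ ⟨by linarith, by linarith⟩)
    have hK' := hK (θ + 1) (by linarith)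
    rw [deriv_digamma_add_one hθ, ← inv_pow] at hK'
    rw [digamma_add_one hθ] at hM'
    nlinarith [sq_nonneg (2 * digamma θ + θ⁻¹)]

/-- there is a constant `c > 0` such that for all `θ > 0`,
`Var_θ(log X) ≤ c + 2 (E_θ log X)²` for `X ~ Gamma(θ,1)`; equivalently, the trigamma
function satisfies `ψ'(θ) ≤ c + 2 ψ(θ)²` for all `θ > 0`. -/
theorem variance_log_gamma_bound :
    ∃ c : ℝ, 0 < c ∧
      (∀ θ : ℝ, 0 < θ →
        (∫ x, (Real.log x - ∫ y, Real.log y ∂(gammaMeasure θ 1)) ^ 2 ∂(gammaMeasure θ 1))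
          ≤ c + 2 * (∫ y, Real.log y ∂(gammaMeasure θ 1)) ^ 2) ∧
      (∀ θ : ℝ, 0 < θ → deriv digamma θ ≤ c + 2 * (digamma θ) ^ 2) := by
  obtain ⟨c, hc, h⟩ := exists_deriv_digamma_le_add_two_mul_sq
  refine ⟨c, hc, fun θ hθ ↦ ?_, h⟩
  rw [integral_sq_log_sub_gammaMeasure hθ, integral_log_gammaMeasure hθ]
  exact h θ hθ
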